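/- If φ is a bisimulation abstraction of a finite MDP (matching rewards and matching pushforward transition distributions for φ-equivalent states), then for every discount γ ∈ [0,1) the optimal value function satisfies V*(s) = V*(t) whenever φ(s) = φ(t). -/

import Mathlib

/-- Distributions with the same pushforward along `φ` agree on functions factoring through `φ`. -/
theorem sum_mul_comp_eq_of_fiber_sums_eq {S X : Type*} [Fintype S] [Fintype X] [DecidableEq X]
    (φ : S → X) (p q : S → ℝ)
    (h : ∀ x, ∑ u ∈ Finset.univ.filter (fun u => φ u = x), p u =
      ∑ u ∈ Finset.univ.filter (fun u => φ u = x), q u) (m : X → ℝ) :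
    ∑ u, p u * m (φ u) = ∑ u, q u * m (φ u) := by
  have key (r : S → ℝ) : ∑ u, r u * m (φ u) =
      ∑ x, (∑ u ∈ Finset.univ.filter (fun u => φ u = x), r u) * m x := by
    rw [← Finset.sum_fiberwise Finset.univ φ]
    refine Finset.sum_congr rfl fun x _ => ?_
    rw [Finset.sum_mul]
    refine Finset.sum_congr rfl fun u hu => ?_
    rw [(Finset.mem_filter.mp hu).2]
  rw [key p, key q]
  exact Finset.sum_congr rfl fun x _ => by rw [h x]

/-- If `V` oscillates by at most `D` on each fiber of `φ`, the expectations of `V` under two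
probability distributions with the same pushforward along `φ` differ by at most `D`. -/
theorem sum_mul_le_sum_mul_add_of_fiber_osc_le {S X : Type*} [Fintype S] [Fintype X]
    [DecidableEq X] (φ : S → X) (p q : S → ℝ) (hp : ∀ u, 0 ≤ p u) (hp1 : ∑ u, p u = 1)
    (hq : ∀ u, 0 ≤ q u)
    (h : ∀ x, ∑ u ∈ Finset.univ.filter (fun u => φ u = x), p u =
      ∑ u ∈ Finset.univ.filter (fun u => φ u = x), q u)
    (V : S → ℝ) (D : ℝ) (hD : ∀ s t, φ s = φ t → V s ≤ V t + D) :
    ∑ u, p u * V u ≤ ∑ u, q u * V u + D := by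
  let m : X → ℝ := fun x => sInf (V '' {u | φ u = x})
  have hm_le (u : S) : m (φ u) ≤ V u :=
    csInf_le (Set.toFinite _).bddBelow ⟨u, rfl, rfl⟩
  have hle_m (u : S) : V u ≤ m (φ u) + D := by
    have : V u - D ≤ m (φ u) := by
      refine le_csInf ⟨V u, u, rfl, rfl⟩ ?_
      rintro _ ⟨v, hv, rfl⟩
      linarith [hD u v (Eq.symm hv)]
    linarith
  calc ∑ u, p u * V u ≤ ∑ u, p u * (m (φ u) + D) :=
        Finset.sum_le_sum fun u _ => mul_le_mul_of_nonneg_left (hle_m u) (hp u)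
    _ = ∑ u, p u * m (φ u) + D := by
        simp only [mul_add, Finset.sum_add_distrib, ← Finset.sum_mul, hp1, one_mul]
    _ = ∑ u, q u * m (φ u) + D := by rw [sum_mul_comp_eq_of_fiber_sums_eq φ p q h m]
    _ ≤ ∑ u, q u * V u + D := by
        gcongr with u
        · exact hq u
        · exact hm_le u

/-- If `φ` is a bisimulation abstraction of a finite MDP (matching
rewards and matching pushforward transition distributions for `φ`-equivalent
states), then for every discount `γ ∈ [0,1)` the optimal value function (the
fixed point of the Bellman optimality operator) satisfies `V*(s) = V*(t)`
whenever `φ(s) = φ(t)`. -/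
theorem bisimulation_preserves_optimal_value
    {S A X : Type} [Fintype S] [Fintype A] [Nonempty A] [Fintype X]
    [DecidableEq X]
    (T : S → A → S → ℝ) (R : S → A → ℝ)
    (hT0 : ∀ s a s', 0 ≤ T s a s') (hT1 : ∀ s a, ∑ s', T s a s' = 1)
    (γ : ℝ) (hγ0 : 0 ≤ γ) (hγ1 : γ < 1)
    (φ : S → X)
    (hbisimR : ∀ s t a, φ s = φ t → R s a = R t a)
    (hbisimT : ∀ s t a x, φ s = φ t →
      (∑ s' ∈ Finset.univ.filter (fun s' => φ s' = x), T s a s') =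
      (∑ s' ∈ Finset.univ.filter (fun s' => φ s' = x), T t a s'))
    (Vstar : S → ℝ)
    (hVstar : ∀ s, Vstar s = ⨆ a : A, (R s a + γ * ∑ s', T s a s' * Vstar s')) :
    ∀ s t, φ s = φ t → Vstar s = Vstar t := by
  have contract (D : ℝ) (hD : ∀ s t, φ s = φ t → Vstar s ≤ Vstar t + D) :
      ∀ s t, φ s = φ t → Vstar s ≤ Vstar t + γ * D := by
    intro s t hst
    rw [hVstar s]
    refine ciSup_le fun a => ?_
    have hexp := mul_le_mul_of_nonneg_left
      (sum_mul_le_sum_mul_add_of_fiber_osc_le φ (T s a) (T t a) (hT0 s a) (hT1 s a) (hT0 t a)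
        (fun x => hbisimT s t a x hst) Vstar D hD) hγ0
    have hsup : R t a + γ * ∑ s', T t a s' * Vstar s' ≤ Vstar t := by
      rw [hVstar t]
      exact le_ciSup (f := fun a => R t a + γ * ∑ s', T t a s' * Vstar s')
        (Set.finite_range _).bddAbove a
    rw [hbisimR s t a hst]
    linarith
  have le_of_equiv : ∀ s t, φ s = φ t → Vstar s ≤ Vstar t := by
    intro s t hst
    have : Nonempty {p : S × S // φ p.1 = φ p.2} := ⟨⟨(s, t), hst⟩⟩
    obtain ⟨⟨⟨u, v⟩, huv⟩, hmax⟩ := Finite.exists_max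
      fun p : {p : S × S // φ p.1 = φ p.2} => Vstar p.1.1 - Vstar p.1.2
    have hbound : ∀ s t, φ s = φ t → Vstar s ≤ Vstar t + (Vstar u - Vstar v) := by
      intro s t hst
      have := hmax ⟨(s, t), hst⟩
      dsimp only at this
      linarith
    have hcontr := contract _ hbound u v huv
    have hnonpos : Vstar u - Vstar v ≤ 0 := by nlinarith
    linarith [hbound s t hst]
  exact fun s t hst => le_antisymm (le_of_equiv s t hst) (le_of_equiv t s hst.symm)
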